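/- In the induced A_k-module R_{j,Δ,ω} with generating vector v, the following hold: (a) for each n ∈ ℕ, G⁺ · (G⁻)^{n+1} v = 0 if and only if ω = ω⁺_{j−n−1,Δ}; (b) for each n ∈ ℕ, G⁻ · (G⁺)^{n+1} v = 0 if and only if ω = ω⁻_{j+n+1,Δ}; (c) R_{j,Δ,ω} is a simple A_k-module if and only if ω ≠ ω⁺_{i,Δ} for every i ∈ j + ℤ. -/

import Mathlib

noncomputable section

namespace BP

/-- The free `ℂ`-algebra on four generators `J, G⁺, G⁻, L`. -/
abbrev F : Type := FreeAlgebra ℂ (Fin 4)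

def jF : F := FreeAlgebra.ι ℂ 0
def gpF : F := FreeAlgebra.ι ℂ 1
def gmF : F := FreeAlgebra.ι ℂ 2
def lF : F := FreeAlgebra.ι ℂ 3

/-- `f_k(J, L) = 3J² − (k+3)L − (1/8)(k+1)(2k+3)·1`, as an element of the free algebra. -/
def fF (k : ℂ) : F :=
  3 * jF ^ 2 - algebraMap ℂ F (k + 3) * lF - algebraMap ℂ F (1/8 * (k + 1) * (2*k + 3))

/-- The defining relations of `A_k`: `L` is central, `[J,G⁺] = G⁺`, `[J,G⁻] = −G⁻`,
`[G⁺,G⁻] = f_k(J,L)`. -/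
inductive Rel (k : ℂ) : F → F → Prop
  | lj : Rel k (lF * jF) (jF * lF)
  | lgp : Rel k (lF * gpF) (gpF * lF)
  | lgm : Rel k (lF * gmF) (gmF * lF)
  | jgp : Rel k (jF * gpF - gpF * jF) gpF
  | jgm : Rel k (jF * gmF - gmF * jF) (-gmF)
  | gpgm : Rel k (gpF * gmF - gmF * gpF) (fF k)

/-- The unital associative `ℂ`-algebra `A_k`: the quotient of the free algebra on
`J, G⁺, G⁻, L` by the two-sided ideal generated by the defining relations. -/
def A (k : ℂ) : Type := RingQuot (Rel k)

instance (k : ℂ) : Ring (A k) := inferInstanceAs (Ring (RingQuot (Rel k)))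
instance (k : ℂ) : Algebra ℂ (A k) := inferInstanceAs (Algebra ℂ (RingQuot (Rel k)))

/-- The quotient map `F →ₐ[ℂ] A_k`. -/
def mk (k : ℂ) : F →ₐ[ℂ] A k := RingQuot.mkAlgHom ℂ (Rel k)

/-- The generator `J` of `A_k`. -/
def J (k : ℂ) : A k := mk k jF
/-- The generator `G⁺` of `A_k`. -/
def Gp (k : ℂ) : A k := mk k gpF
/-- The generator `G⁻` of `A_k`. -/
def Gm (k : ℂ) : A k := mk k gmF
/-- The generator `L` of `A_k`. -/
def L (k : ℂ) : A k := mk k lF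

/-- The central element `Ω = G⁺G⁻ + G⁻G⁺ + 2J³ + J − 2J((k+3)L + (1/8)(k+1)(2k+3)·1)`. -/
def Omega (k : ℂ) : A k :=
  Gp k * Gm k + Gm k * Gp k + 2 * J k ^ 3 + J k
    - 2 * J k * (algebraMap ℂ (A k) (k + 3) * L k
        + algebraMap ℂ (A k) (1/8 * (k + 1) * (2*k + 3)))

/-- The left ideal of `A_k` by which one quotients to obtain the induced module
`R_{j,Δ,ω} = A_k ⊗_{C_k} ℂ_{j,Δ,ω}`: it is generated by `J − j·1`, `L − Δ·1` and
`Ω − ω·1`. -/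
def denseIdeal (k j Δ ω : ℂ) : Submodule (A k) (A k) :=
  Submodule.span (A k)
    {J k - algebraMap ℂ (A k) j, L k - algebraMap ℂ (A k) Δ,
      Omega k - algebraMap ℂ (A k) ω}

/-- The induced module `R_{j,Δ,ω} = A_k ⊗_{C_k} ℂ_{j,Δ,ω}`, realised as the quotient
`A_k / A_k·(J−j, L−Δ, Ω−ω)`. -/
abbrev Rmod (k j Δ ω : ℂ) : Type := A k ⧸ denseIdeal k j Δ ω

/-- The generating vector `v = 1 ⊗ 1` of `R_{j,Δ,ω}`. -/
def rv (k j Δ ω : ℂ) : Rmod k j Δ ω := Submodule.Quotient.mk (1 : A k)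

/-- `ω⁺_{j,Δ} = (2j+1)(j(j+1) − (k+3)Δ − (1/8)(k+1)(2k+3))`. -/
def omegaP (k j Δ : ℂ) : ℂ :=
  (2*j + 1) * (j*(j + 1) - (k + 3)*Δ - 1/8 * (k + 1) * (2*k + 3))

/-- `ω⁻_{j,Δ} = (2j−1)(j(j−1) − (k+3)Δ − (1/8)(k+1)(2k+3))`. -/
def omegaM (k j Δ : ℂ) : ℂ :=
  (2*j - 1) * (j*(j - 1) - (k + 3)*Δ - 1/8 * (k + 1) * (2*k + 3))

section Relations

variable (k : ℂ)

theorem L_mul_Gp : L k * Gp k = Gp k * L k := by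
  have h : mk k (lF * gpF) = mk k (gpF * lF) := RingQuot.mkAlgHom_rel ℂ (Rel.lgp (k := k))
  rwa [map_mul, map_mul] at h

theorem L_mul_Gm : L k * Gm k = Gm k * L k := by
  have h : mk k (lF * gmF) = mk k (gmF * lF) := RingQuot.mkAlgHom_rel ℂ (Rel.lgm (k := k))
  rwa [map_mul, map_mul] at h

theorem J_mul_Gp : J k * Gp k = Gp k * J k + Gp k := by
  have h : mk k (jF * gpF - gpF * jF) = mk k gpF := RingQuot.mkAlgHom_rel ℂ (Rel.jgp (k := k))
  rw [map_sub, map_mul, map_mul] at h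
  exact sub_eq_iff_eq_add'.mp h

theorem J_mul_Gm : J k * Gm k = Gm k * J k - Gm k := by
  have h : mk k (jF * gmF - gmF * jF) = mk k (-gmF) := RingQuot.mkAlgHom_rel ℂ (Rel.jgm (k := k))
  rw [map_sub, map_mul, map_mul, map_neg] at h
  rw [sub_eq_add_neg]
  exact sub_eq_iff_eq_add'.mp h

theorem Gp_mul_Gm : Gp k * Gm k = Gm k * Gp k + (3 * J k ^ 2
    - algebraMap ℂ (A k) (k + 3) * L k - algebraMap ℂ (A k) (1/8 * (k + 1) * (2*k + 3))) := by
  have h : mk k (gpF * gmF - gmF * gpF) = mk k (fF k) :=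
    RingQuot.mkAlgHom_rel ℂ (Rel.gpgm (k := k))
  rw [fF, map_sub, map_mul, map_mul, map_sub, map_sub, map_mul, map_mul, map_pow, map_ofNat,
    AlgHom.commutes, AlgHom.commutes] at h
  exact sub_eq_iff_eq_add'.mp h

variable {k}

theorem A.induction {P : A k → Prop} (hc : ∀ c, P (algebraMap ℂ (A k) c)) (hJ : P (J k))
    (hGp : P (Gp k)) (hGm : P (Gm k)) (hL : P (L k)) (hmul : ∀ a b, P a → P b → P (a * b))
    (hadd : ∀ a b, P a → P b → P (a + b)) (a : A k) : P a := by
  obtain ⟨x, rfl⟩ : ∃ x, mk k x = a := RingQuot.mkAlgHom_surjective ℂ (Rel k) a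
  induction x using FreeAlgebra.induction with
  | grade0 r => rw [AlgHom.commutes]; exact hc r
  | grade1 i => fin_cases i <;> assumption
  | mul a b ha hb => rw [map_mul]; exact hmul _ _ ha hb
  | add a b ha hb => rw [map_add]; exact hadd _ _ ha hb

end Relations

section WeightVectors

variable {k Δ ω μ : ℂ} {M : Type*} [AddCommGroup M] [Module ℂ M] [Module (A k) M]
  [IsScalarTower ℂ (A k) M]

instance smulCommClass_A : SMulCommClass ℂ (A k) M := IsScalarTower.to_smulCommClass

/-- A `ℂ`-subspace stable under the generators of `A_k` is stable under `A_k`. -/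
theorem smul_mem_of_generators {S : Submodule ℂ M} (hJ : ∀ x ∈ S, J k • x ∈ S)
    (hGp : ∀ x ∈ S, Gp k • x ∈ S) (hGm : ∀ x ∈ S, Gm k • x ∈ S) (hL : ∀ x ∈ S, L k • x ∈ S)
    (a : A k) : ∀ x ∈ S, a • x ∈ S := by
  induction a using A.induction with
  | hc c => intro x hx; rw [algebraMap_smul]; exact S.smul_mem c hx
  | hJ => exact hJ
  | hGp => exact hGp
  | hGm => exact hGm
  | hL => exact hL
  | hmul a b ha hb => intro x hx; rw [mul_smul]; exact ha _ (hb x hx)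
  | hadd a b ha hb => intro x hx; rw [add_smul]; exact S.add_mem (ha x hx) (hb x hx)

/-- `x` has `J`-eigenvalue `μ` and `L`-eigenvalue `Δ`, and `G⁻G⁺`, `G⁺G⁻` act on it as they do
on a vector of `Ω`-eigenvalue `ω`. -/
structure IsWeightVector (k Δ ω μ : ℂ) [Module (A k) M] (x : M) : Prop where
  J_smul : J k • x = μ • x
  L_smul : L k • x = Δ • x
  Gm_Gp_smul : Gm k • Gp k • x = ((ω - omegaP k μ Δ) / 2) • x
  Gp_Gm_smul : Gp k • Gm k • x = ((ω - omegaM k μ Δ) / 2) • x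

theorem Gp_Gm_smul_eq {x : M} (hJ : J k • x = μ • x) (hL : L k • x = Δ • x) :
    Gp k • Gm k • x = Gm k • Gp k • x
      + (3 * μ ^ 2 - (k + 3) * Δ - 1/8 * (k + 1) * (2*k + 3)) • x := by
  have h3 : (3 : A k) = algebraMap ℂ (A k) 3 := (map_ofNat _ 3).symm
  rw [← mul_smul, Gp_mul_Gm, h3]
  simp only [add_smul, sub_smul, mul_smul, pow_two, algebraMap_smul, hJ, hL, smul_comm (J k) μ]

theorem IsWeightVector.of_Omega {x : M} (hJ : J k • x = μ • x) (hL : L k • x = Δ • x)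
    (hΩ : Omega k • x = ω • x) : IsWeightVector k Δ ω μ x := by
  have h := Gp_Gm_smul_eq hJ hL
  have h2 : (2 : A k) = algebraMap ℂ (A k) 2 := (map_ofNat _ 2).symm
  rw [Omega, h2] at hΩ
  simp only [add_smul, sub_smul, mul_smul, pow_three, algebraMap_smul, hJ, hL, smul_comm (J k) μ,
    smul_comm (J k) Δ, smul_add, smul_comm (J k) (_ : ℂ), h] at hΩ
  have key : Gm k • Gp k • x = ((ω - omegaP k μ Δ) / 2) • x := by
    rw [omegaP]
    generalize Gm k • Gp k • x = y at hΩ ⊢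
    linear_combination (norm := module) (1 / 2 : ℂ) • hΩ
  refine ⟨hJ, hL, key, ?_⟩
  rw [h, key, omegaP, omegaM]
  module

theorem IsWeightVector.Gp_smul {x : M} (h : IsWeightVector k Δ ω μ x) :
    IsWeightVector k Δ ω (μ + 1) (Gp k • x) := by
  have hJ : J k • Gp k • x = (μ + 1) • Gp k • x := by
    rw [← mul_smul, J_mul_Gp, add_smul, mul_smul, h.J_smul, smul_comm, add_smul, one_smul]
  have hL : L k • Gp k • x = Δ • Gp k • x := by
    rw [← mul_smul, L_mul_Gp, mul_smul, h.L_smul, smul_comm]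
  have hpm : Gp k • Gm k • Gp k • x = ((ω - omegaM k (μ + 1) Δ) / 2) • Gp k • x := by
    rw [h.Gm_Gp_smul, smul_comm, omegaP, omegaM]
    generalize Gp k • x = y
    module
  refine ⟨hJ, hL, ?_, hpm⟩
  have := Gp_Gm_smul_eq hJ hL
  rw [← sub_eq_iff_eq_add] at this
  rw [← this, hpm, omegaP, omegaM]
  generalize Gp k • x = y
  module

theorem IsWeightVector.Gm_smul {x : M} (h : IsWeightVector k Δ ω μ x) :
    IsWeightVector k Δ ω (μ - 1) (Gm k • x) := by
  have hJ : J k • Gm k • x = (μ - 1) • Gm k • x := by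
    rw [← mul_smul, J_mul_Gm, sub_smul, mul_smul, h.J_smul, smul_comm, sub_smul, one_smul]
  have hL : L k • Gm k • x = Δ • Gm k • x := by
    rw [← mul_smul, L_mul_Gm, mul_smul, h.L_smul, smul_comm]
  have hmp : Gm k • Gp k • Gm k • x = ((ω - omegaP k (μ - 1) Δ) / 2) • Gm k • x := by
    rw [h.Gp_Gm_smul, smul_comm, omegaP, omegaM]
    generalize Gm k • x = y
    module
  refine ⟨hJ, hL, hmp, ?_⟩
  rw [Gp_Gm_smul_eq hJ hL, hmp, omegaP, omegaM]
  generalize Gm k • x = y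
  module

theorem IsWeightVector.Gp_pow_smul {x : M} (h : IsWeightVector k Δ ω μ x) (n : ℕ) :
    IsWeightVector k Δ ω (μ + n) (Gp k ^ n • x) := by
  induction n with
  | zero => simpa using h
  | succ n ih =>
    rw [pow_succ', mul_smul, Nat.cast_succ, ← add_assoc]
    exact ih.Gp_smul

theorem IsWeightVector.Gm_pow_smul {x : M} (h : IsWeightVector k Δ ω μ x) (n : ℕ) :
    IsWeightVector k Δ ω (μ - n) (Gm k ^ n • x) := by
  induction n with
  | zero => simpa using h
  | succ n ih =>
    rw [pow_succ', mul_smul, Nat.cast_succ, ← sub_sub]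
    exact ih.Gm_smul

theorem aeval_J_smul {x : M} (h : J k • x = μ • x) (p : Polynomial ℂ) :
    Polynomial.aeval (J k) p • x = p.eval μ • x := by
  induction p using Polynomial.induction_on' with
  | add p q hp hq => simp only [map_add, add_smul, hp, hq, Polynomial.eval_add]
  | monomial n c =>
    simp only [Polynomial.aeval_monomial, Polynomial.eval_monomial, mul_smul, algebraMap_smul]
    congr 1
    induction n with
    | zero => simp
    | succ n ih => rw [pow_succ, mul_smul, h, smul_comm, ih, smul_smul, pow_succ']

end WeightVectors

section Model

/-- The space of functions `ℤ → ℂ`, carrying the action of `A_k` in which `J` multiplies the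
value at `m` by `j + m`. -/
def DenseModel (_k _j _Δ _ω : ℂ) : Type := ℤ → ℂ

namespace DenseModel

variable (k j Δ ω : ℂ)

instance : AddCommGroup (DenseModel k j Δ ω) := inferInstanceAs (AddCommGroup (ℤ → ℂ))
instance : Module ℂ (DenseModel k j Δ ω) := inferInstanceAs (Module ℂ (ℤ → ℂ))

/-- The scalar by which `G⁻G⁺` acts in weight `j + m`. -/
def coeff (m : ℤ) : ℂ := (ω - omegaP k (j + m) Δ) / 2

/-- The matrix coefficient of `G⁺` from weight `j + m` to weight `j + m + 1`. -/
def up (m : ℤ) : ℂ := if 0 ≤ m then 1 else coeff k j Δ ω m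

/-- The matrix coefficient of `G⁻` from weight `j + m + 1` to weight `j + m`. -/
def down (m : ℤ) : ℂ := if 0 ≤ m then coeff k j Δ ω m else 1

theorem up_mul_down (m : ℤ) : up k j Δ ω m * down k j Δ ω m = coeff k j Δ ω m := by
  unfold up down
  split_ifs <;> simp

/-- The operator by which `J` acts. -/
def opJ : Module.End ℂ (ℤ → ℂ) where
  toFun f m := (j + m) * f m
  map_add' f g := by ext; simp [mul_add]
  map_smul' c f := by ext; simp [mul_left_comm]

/-- The operator by which `G⁺` acts. -/
def opGp : Module.End ℂ (ℤ → ℂ) where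
  toFun f m := up k j Δ ω (m - 1) * f (m - 1)
  map_add' f g := by ext; simp [mul_add]
  map_smul' c f := by ext; simp [mul_left_comm]

/-- The operator by which `G⁻` acts. -/
def opGm : Module.End ℂ (ℤ → ℂ) where
  toFun f m := down k j Δ ω m * f (m + 1)
  map_add' f g := by ext; simp [mul_add]
  map_smul' c f := by ext; simp [mul_left_comm]

theorem opJ_apply (f : ℤ → ℂ) (m : ℤ) : opJ j f m = (j + m) * f m := rfl

theorem opGp_apply (f : ℤ → ℂ) (m : ℤ) :
    opGp k j Δ ω f m = up k j Δ ω (m - 1) * f (m - 1) := rfl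

theorem opGm_apply (f : ℤ → ℂ) (m : ℤ) : opGm k j Δ ω f m = down k j Δ ω m * f (m + 1) := rfl

/-- The images of the four generators. -/
def freeAction : F →ₐ[ℂ] Module.End ℂ (ℤ → ℂ) :=
  FreeAlgebra.lift ℂ ![opJ j, opGp k j Δ ω, opGm k j Δ ω, algebraMap ℂ _ Δ]

theorem freeAction_jF : freeAction k j Δ ω jF = opJ j := by simp [freeAction, jF]
theorem freeAction_gpF : freeAction k j Δ ω gpF = opGp k j Δ ω := by simp [freeAction, gpF]
theorem freeAction_gmF : freeAction k j Δ ω gmF = opGm k j Δ ω := by simp [freeAction, gmF]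
theorem freeAction_lF : freeAction k j Δ ω lF = algebraMap ℂ _ Δ := by simp [freeAction, lF]

theorem opGp_opGm_apply (f : ℤ → ℂ) (m : ℤ) :
    opGp k j Δ ω (opGm k j Δ ω f) m = coeff k j Δ ω (m - 1) * f m := by
  rw [opGp_apply, opGm_apply, ← mul_assoc, up_mul_down, sub_add_cancel]

theorem opGm_opGp_apply (f : ℤ → ℂ) (m : ℤ) :
    opGm k j Δ ω (opGp k j Δ ω f) m = coeff k j Δ ω m * f m := by
  rw [opGm_apply, opGp_apply, ← mul_assoc, add_sub_cancel_right, mul_comm (down _ _ _ _ _),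
    up_mul_down]

theorem freeAction_eq_of_rel ⦃x y : F⦄ (h : Rel k x y) :
    freeAction k j Δ ω x = freeAction k j Δ ω y := by
  cases h with
  | lj => rw [map_mul, map_mul, freeAction_lF, Algebra.commutes]
  | lgp => rw [map_mul, map_mul, freeAction_lF, Algebra.commutes]
  | lgm => rw [map_mul, map_mul, freeAction_lF, Algebra.commutes]
  | jgp =>
    simp only [map_sub, map_mul, freeAction_jF, freeAction_gpF]
    ext1 f
    funext m
    simp only [LinearMap.sub_apply, Module.End.mul_apply, Pi.sub_apply, opJ_apply, opGp_apply]
    push_cast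
    ring
  | jgm =>
    simp only [map_sub, map_mul, map_neg, freeAction_jF, freeAction_gmF]
    ext1 f
    funext m
    simp only [LinearMap.sub_apply, Module.End.mul_apply, Pi.sub_apply, opJ_apply, opGm_apply,
      LinearMap.neg_apply, Pi.neg_apply]
    push_cast
    ring
  | gpgm =>
    have h3 : (3 : F) = algebraMap ℂ F 3 := (map_ofNat _ 3).symm
    simp only [fF, h3, map_sub, map_mul, map_pow, AlgHom.commutes, freeAction_jF, freeAction_gpF,
      freeAction_gmF, freeAction_lF]
    refine LinearMap.ext fun f => funext fun m => ?_
    simp only [← map_mul, LinearMap.sub_apply, Module.End.mul_apply, Pi.sub_apply, pow_two,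
      opGp_opGm_apply, opGm_opGp_apply, Module.algebraMap_end_apply, Pi.smul_apply, opJ_apply,
      smul_eq_mul, coeff, omegaP]
    push_cast
    ring

/-- The action of `A_k` on functions `ℤ → ℂ`. -/
def action : A k →ₐ[ℂ] Module.End ℂ (ℤ → ℂ) :=
  RingQuot.liftAlgHom ℂ ⟨freeAction k j Δ ω, freeAction_eq_of_rel k j Δ ω⟩

theorem action_mk (x : F) : action k j Δ ω (mk k x) = freeAction k j Δ ω x :=
  RingQuot.liftAlgHom_mkAlgHom_apply ℂ (freeAction k j Δ ω) (freeAction_eq_of_rel k j Δ ω) x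

instance : Module (A k) (DenseModel k j Δ ω) :=
  Module.compHom (ℤ → ℂ) (action k j Δ ω).toRingHom

theorem smul_def (a : A k) (f : DenseModel k j Δ ω) : a • f = action k j Δ ω a f := rfl

instance : IsScalarTower ℂ (A k) (DenseModel k j Δ ω) where
  smul_assoc c a f := by rw [smul_def, smul_def, map_smul]; rfl

variable {k j Δ ω}

theorem J_smul_apply (f : DenseModel k j Δ ω) (m : ℤ) : (J k • f) m = (j + m) * f m := by
  rw [smul_def, J, action_mk, freeAction_jF]; rfl

theorem Gp_smul_apply (f : DenseModel k j Δ ω) (m : ℤ) :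
    (Gp k • f) m = up k j Δ ω (m - 1) * f (m - 1) := by
  rw [smul_def, Gp, action_mk, freeAction_gpF]; rfl

theorem Gm_smul_apply (f : DenseModel k j Δ ω) (m : ℤ) :
    (Gm k • f) m = down k j Δ ω m * f (m + 1) := by
  rw [smul_def, Gm, action_mk, freeAction_gmF]; rfl

theorem L_smul (f : DenseModel k j Δ ω) : L k • f = Δ • f := by
  rw [smul_def, L, action_mk, freeAction_lF]; rfl

variable (k j Δ ω)

/-- The indicator function of `m`. -/
def basisVec (m : ℤ) : DenseModel k j Δ ω := (Pi.single m 1 : ℤ → ℂ)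

variable {k j Δ ω}

theorem basisVec_self (m : ℤ) : basisVec k j Δ ω m m = 1 :=
  Pi.single_eq_same (M := fun _ : ℤ => ℂ) m 1

theorem basisVec_of_ne {m i : ℤ} (h : i ≠ m) : basisVec k j Δ ω m i = 0 :=
  Pi.single_eq_of_ne (M := fun _ : ℤ => ℂ) h 1

theorem basisVec_ne_zero (m : ℤ) : basisVec k j Δ ω m ≠ 0 := fun h =>
  one_ne_zero ((basisVec_self m).symm.trans (congrFun h m))

theorem J_smul_basisVec (m : ℤ) :
    J k • basisVec k j Δ ω m = (j + m) • basisVec k j Δ ω m := by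
  refine funext fun i => ?_
  rw [J_smul_apply]
  change _ = (j + m) * basisVec k j Δ ω m i
  by_cases h : i = m
  · rw [h]
  · rw [basisVec_of_ne h, mul_zero, mul_zero]

theorem Gp_smul_basisVec (m : ℤ) :
    Gp k • basisVec k j Δ ω m = up k j Δ ω m • basisVec k j Δ ω (m + 1) := by
  refine funext fun i => ?_
  rw [Gp_smul_apply]
  change _ = up k j Δ ω m * basisVec k j Δ ω (m + 1) i
  by_cases h : i = m + 1
  · rw [h, add_sub_cancel_right, basisVec_self, basisVec_self]
  · rw [basisVec_of_ne h, basisVec_of_ne (by lia), mul_zero, mul_zero]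

theorem Gm_smul_basisVec (m : ℤ) :
    Gm k • basisVec k j Δ ω m = down k j Δ ω (m - 1) • basisVec k j Δ ω (m - 1) := by
  refine funext fun i => ?_
  rw [Gm_smul_apply]
  change _ = down k j Δ ω (m - 1) * basisVec k j Δ ω (m - 1) i
  by_cases h : i = m - 1
  · rw [h, sub_add_cancel, basisVec_self, basisVec_self]
  · rw [basisVec_of_ne h, basisVec_of_ne (by lia), mul_zero, mul_zero]

theorem Gp_pow_smul_basisVec_zero (n : ℕ) :
    Gp k ^ n • basisVec k j Δ ω 0 = basisVec k j Δ ω n := by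
  induction n with
  | zero => simp
  | succ n ih => rw [pow_succ', mul_smul, ih, Gp_smul_basisVec, up, if_pos (by lia), one_smul,
      Nat.cast_succ]

theorem Gm_pow_smul_basisVec_zero (n : ℕ) :
    Gm k ^ n • basisVec k j Δ ω 0 = basisVec k j Δ ω (-n) := by
  induction n with
  | zero => simp
  | succ n ih => rw [pow_succ', mul_smul, ih, Gm_smul_basisVec, down, if_neg (by lia), one_smul,
      Nat.cast_succ, neg_add']

theorem Omega_smul_basisVec_zero :
    Omega k • basisVec k j Δ ω 0 = ω • basisVec k j Δ ω 0 := by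
  have hJ : J k • basisVec k j Δ ω 0 = j • basisVec k j Δ ω 0 := by
    simpa using J_smul_basisVec (k := k) (j := j) (Δ := Δ) (ω := ω) 0
  have hmp : Gm k • Gp k • basisVec k j Δ ω 0 = coeff k j Δ ω 0 • basisVec k j Δ ω 0 := by
    rw [Gp_smul_basisVec, smul_comm, Gm_smul_basisVec, smul_smul, add_sub_cancel_right,
      up_mul_down]
  have h2 : (2 : A k) = algebraMap ℂ (A k) 2 := (map_ofNat _ 2).symm
  rw [Omega, h2]
  simp only [add_smul, sub_smul, mul_smul, pow_three, algebraMap_smul, hJ, L_smul,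
    smul_add, smul_comm (J k) (_ : ℂ), Gp_Gm_smul_eq hJ (L_smul _), hmp, coeff, omegaP,
    Int.cast_zero, add_zero]
  module

variable (k j Δ ω)

/-- The homomorphism from the induced module sending the generating vector to the indicator
function of `0`. -/
def ofInduced : Rmod k j Δ ω →ₗ[A k] DenseModel k j Δ ω :=
  Submodule.liftQ _ (LinearMap.toSpanSingleton (A k) _ (basisVec k j Δ ω 0)) <| by
    rw [denseIdeal, Submodule.span_le]
    rintro x (rfl | rfl | rfl)
    · simp [sub_smul, J_smul_basisVec]
    · simp [sub_smul, L_smul]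
    · simp [sub_smul, Omega_smul_basisVec_zero]

theorem ofInduced_rv : ofInduced k j Δ ω (rv k j Δ ω) = basisVec k j Δ ω 0 := by
  change (1 : A k) • basisVec k j Δ ω 0 = _
  exact one_smul _ _

end DenseModel

end Model

section InducedModule

variable (k j Δ ω : ℂ)

open DenseModel

theorem Gp_pow_smul_rv_ne_zero (n : ℕ) : Gp k ^ n • rv k j Δ ω ≠ 0 := fun h =>
  basisVec_ne_zero (k := k) (j := j) (Δ := Δ) (ω := ω) n <| by
    rw [← Gp_pow_smul_basisVec_zero, ← ofInduced_rv, ← map_smul, h, map_zero]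

theorem Gm_pow_smul_rv_ne_zero (n : ℕ) : Gm k ^ n • rv k j Δ ω ≠ 0 := fun h =>
  basisVec_ne_zero (k := k) (j := j) (Δ := Δ) (ω := ω) (-n) <| by
    rw [← Gm_pow_smul_basisVec_zero, ← ofInduced_rv, ← map_smul, h, map_zero]

theorem smul_rv (a : A k) : a • rv k j Δ ω = Submodule.Quotient.mk a := by
  rw [rv, ← Submodule.Quotient.mk_smul, smul_eq_mul, mul_one]

theorem smul_rv_of_sub_mem {a : A k} {c : ℂ} (h : a - algebraMap ℂ (A k) c ∈ denseIdeal k j Δ ω) :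
    a • rv k j Δ ω = c • rv k j Δ ω := by
  rw [← algebraMap_smul (A k) c, smul_rv, smul_rv]
  exact (Submodule.Quotient.eq _).mpr h

theorem isWeightVector_rv : IsWeightVector k Δ ω j (rv k j Δ ω) :=
  .of_Omega (smul_rv_of_sub_mem _ _ _ _ (Submodule.subset_span (by simp)))
    (smul_rv_of_sub_mem _ _ _ _ (Submodule.subset_span (by simp)))
    (smul_rv_of_sub_mem _ _ _ _ (Submodule.subset_span (by simp)))

/-- The vector `(G⁺)^m v` for `m ≥ 0` and `(G⁻)^(-m) v` for `m < 0`. -/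
def weightVec : ℤ → Rmod k j Δ ω
  | .ofNat n => Gp k ^ n • rv k j Δ ω
  | .negSucc n => Gm k ^ (n + 1) • rv k j Δ ω

theorem weightVec_natCast (n : ℕ) : weightVec k j Δ ω n = Gp k ^ n • rv k j Δ ω := rfl

theorem weightVec_neg_natCast (n : ℕ) : weightVec k j Δ ω (-n) = Gm k ^ n • rv k j Δ ω := by
  cases n with
  | zero => simpa using weightVec_natCast k j Δ ω 0
  | succ n => rfl

theorem weightVec_zero : weightVec k j Δ ω 0 = rv k j Δ ω := by
  simpa using weightVec_natCast k j Δ ω 0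

theorem isWeightVector_weightVec (m : ℤ) :
    IsWeightVector k Δ ω (j + m) (weightVec k j Δ ω m) := by
  obtain ⟨n, rfl | rfl⟩ := m.eq_nat_or_neg
  · rw [weightVec_natCast]
    exact_mod_cast (isWeightVector_rv k j Δ ω).Gp_pow_smul n
  · rw [weightVec_neg_natCast, Int.cast_neg, Int.cast_natCast, ← sub_eq_add_neg]
    exact (isWeightVector_rv k j Δ ω).Gm_pow_smul n

theorem Gp_smul_weightVec_natCast (n : ℕ) :
    Gp k • weightVec k j Δ ω n = weightVec k j Δ ω (n + 1) := by
  rw [← Nat.cast_succ, weightVec_natCast, weightVec_natCast, pow_succ', mul_smul]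

theorem Gm_smul_weightVec_neg_natCast (n : ℕ) :
    Gm k • weightVec k j Δ ω (-n) = weightVec k j Δ ω (-n - 1) := by
  rw [← neg_add', ← Nat.cast_succ, weightVec_neg_natCast, weightVec_neg_natCast, pow_succ',
    mul_smul]

theorem Gm_smul_weightVec_succ (n : ℕ) : Gm k • weightVec k j Δ ω (n + 1)
    = coeff k j Δ ω n • weightVec k j Δ ω n := by
  rw [← Gp_smul_weightVec_natCast, (isWeightVector_weightVec k j Δ ω n).Gm_Gp_smul, coeff]

theorem Gp_smul_weightVec_neg_pred (n : ℕ) : Gp k • weightVec k j Δ ω (-n - 1)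
    = coeff k j Δ ω (-n - 1) • weightVec k j Δ ω (-n) := by
  rw [← Gm_smul_weightVec_neg_natCast, (isWeightVector_weightVec k j Δ ω (-n)).Gp_Gm_smul, coeff,
    omegaP, omegaM]
  congr 2
  push_cast
  ring

theorem span_range_weightVec : Submodule.span ℂ (Set.range (weightVec k j Δ ω)) = ⊤ := by
  set S := Submodule.span ℂ (Set.range (weightVec k j Δ ω)) with hS
  have mem (m : ℤ) : weightVec k j Δ ω m ∈ S := Submodule.subset_span ⟨m, rfl⟩
  have stable (a : A k) (h : ∀ m, a • weightVec k j Δ ω m ∈ S) : ∀ x ∈ S, a • x ∈ S := by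
    intro x hx
    induction hx using Submodule.span_induction with
    | mem x hx => obtain ⟨m, rfl⟩ := hx; exact h m
    | zero => rw [smul_zero]; exact S.zero_mem
    | add x y _ _ hx hy => rw [smul_add]; exact S.add_mem hx hy
    | smul c x _ hx => rw [smul_comm]; exact S.smul_mem c hx
  rw [eq_top_iff]
  rintro x -
  obtain ⟨a, rfl⟩ := Submodule.Quotient.mk_surjective _ x
  rw [← smul_rv]
  refine smul_mem_of_generators (stable _ fun m => ?_) (stable _ fun m => ?_)
    (stable _ fun m => ?_) (stable _ fun m => ?_) a _ (weightVec_zero k j Δ ω ▸ mem 0)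
  · rw [(isWeightVector_weightVec k j Δ ω m).J_smul]
    exact S.smul_mem _ (mem m)
  · obtain ⟨n, rfl | rfl⟩ : ∃ n : ℕ, m = n ∨ m = -n - 1 := by
      rcases le_or_gt 0 m with h | h
      · exact ⟨m.toNat, by lia⟩
      · exact ⟨(-m - 1).toNat, by lia⟩
    · rw [Gp_smul_weightVec_natCast]
      exact mem _
    · rw [Gp_smul_weightVec_neg_pred]
      exact S.smul_mem _ (mem _)
  · obtain ⟨n, rfl | rfl⟩ : ∃ n : ℕ, m = -n ∨ m = n + 1 := by
      rcases le_or_gt m 0 with h | h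
      · exact ⟨(-m).toNat, by lia⟩
      · exact ⟨(m - 1).toNat, by lia⟩
    · rw [Gm_smul_weightVec_neg_natCast]
      exact mem _
    · rw [Gm_smul_weightVec_succ]
      exact S.smul_mem _ (mem _)
  · rw [(isWeightVector_weightVec k j Δ ω m).L_smul]
    exact S.smul_mem _ (mem m)

variable {k j Δ ω}

theorem smul_mem_iff_of_ne_zero {N : Submodule (A k) (Rmod k j Δ ω)} {c : ℂ} (hc : c ≠ 0)
    {x : Rmod k j Δ ω} : c • x ∈ N ↔ x ∈ N :=
  (N.restrictScalars ℂ).smul_mem_iff hc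

theorem exists_weightVec_mem {N : Submodule (A k) (Rmod k j Δ ω)} (hN : N ≠ ⊥) :
    ∃ m, weightVec k j Δ ω m ∈ N := by
  obtain ⟨x, hx, hx0⟩ := N.exists_mem_ne_zero_of_ne_bot hN
  have hspan : x ∈ Submodule.span ℂ (Set.range (weightVec k j Δ ω)) := by
    rw [span_range_weightVec]; trivial
  obtain ⟨c, rfl⟩ := Finsupp.mem_span_range_iff_exists_finsupp.mp hspan
  obtain ⟨m, hm⟩ : c.support.Nonempty := by
    rw [Finset.nonempty_iff_ne_empty]
    intro h
    exact hx0 (by rw [Finsupp.sum, h, Finset.sum_empty])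
  refine ⟨m, (smul_mem_iff_of_ne_zero (Finsupp.mem_support_iff.mp hm)).mp ?_⟩
  convert N.smul_mem (Polynomial.aeval (J k)
    (Lagrange.basis c.support (fun i : ℤ => j + i) m)) hx using 1
  rw [Finsupp.sum, Finset.smul_sum, Finset.sum_eq_single_of_mem m hm]
  · rw [smul_comm, aeval_J_smul (isWeightVector_weightVec k j Δ ω m).J_smul,
      Lagrange.eval_basis_self (v := fun i : ℤ => j + i)
        (fun a _ b _ h => by simpa using h) hm, one_smul]
  · intro i hi him
    rw [smul_comm, aeval_J_smul (isWeightVector_weightVec k j Δ ω i).J_smul,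
      Lagrange.eval_basis_of_ne (v := fun i : ℤ => j + i) him.symm hi, zero_smul, smul_zero]

theorem eq_top_of_rv_mem {N : Submodule (A k) (Rmod k j Δ ω)} (h : rv k j Δ ω ∈ N) : N = ⊤ := by
  rw [eq_top_iff]
  rintro x -
  obtain ⟨a, rfl⟩ := Submodule.Quotient.mk_surjective _ x
  rw [← smul_rv]
  exact N.smul_mem a h

theorem rv_mem_of_weightVec_mem (hω : ∀ m : ℤ, ω ≠ omegaP k (j + m) Δ)
    {N : Submodule (A k) (Rmod k j Δ ω)} {m : ℤ} (hm : weightVec k j Δ ω m ∈ N) :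
    rv k j Δ ω ∈ N := by
  have hcoeff (m : ℤ) : coeff k j Δ ω m ≠ 0 := div_ne_zero (sub_ne_zero.mpr (hω m)) two_ne_zero
  obtain ⟨n, rfl | rfl⟩ := m.eq_nat_or_neg
  · induction n with
    | zero => rwa [Nat.cast_zero, weightVec_zero] at hm
    | succ n ih =>
      refine ih ((smul_mem_iff_of_ne_zero (hcoeff n)).mp ?_)
      rw [← Gm_smul_weightVec_succ]
      exact N.smul_mem _ (by exact_mod_cast hm)
  · induction n with
    | zero => rwa [Nat.cast_zero, neg_zero, weightVec_zero] at hm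
    | succ n ih =>
      refine ih ((smul_mem_iff_of_ne_zero (hcoeff (-n - 1))).mp ?_)
      rw [← Gp_smul_weightVec_neg_pred]
      exact N.smul_mem _ (by rwa [Nat.cast_succ, neg_add'] at hm)

theorem isSimpleModule_of_forall_ne (hω : ∀ m : ℤ, ω ≠ omegaP k (j + m) Δ) :
    IsSimpleModule (A k) (Rmod k j Δ ω) := by
  have : Nontrivial (Rmod k j Δ ω) :=
    ⟨rv k j Δ ω, 0, by simpa using Gp_pow_smul_rv_ne_zero k j Δ ω 0⟩
  rw [isSimpleModule_iff]
  refine ⟨fun N => or_iff_not_imp_left.mpr fun hN => ?_⟩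
  obtain ⟨m, hm⟩ := exists_weightVec_mem hN
  exact eq_top_of_rv_mem (rv_mem_of_weightVec_mem hω hm)

/-- A submodule of the model that avoids the indicator function of `0` but meets the image of the
induced module nontrivially obstructs simplicity. -/
theorem not_isSimpleModule_of_submodule {W : Submodule (A k) (DenseModel k j Δ ω)}
    (h0 : basisVec k j Δ ω 0 ∉ W) {a : A k} (ha : a • basisVec k j Δ ω 0 ∈ W)
    (ha0 : a • rv k j Δ ω ≠ 0) : ¬ IsSimpleModule (A k) (Rmod k j Δ ω) := by
  intro h
  rcases eq_bot_or_eq_top (W.comap (ofInduced k j Δ ω)) with hW | hW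
  · refine ha0 ((Submodule.mem_bot (A k)).mp (hW ▸ ?_))
    rwa [Submodule.mem_comap, map_smul, ofInduced_rv]
  · have hmem : rv k j Δ ω ∈ W.comap (ofInduced k j Δ ω) := hW ▸ Submodule.mem_top
    rw [Submodule.mem_comap, ofInduced_rv] at hmem
    exact h0 hmem

/-- The functions vanishing on `s`, provided that the action does not lead into `s` from outside. -/
def DenseModel.vanishing (s : Set ℤ) (hup : ∀ m ∉ s, m + 1 ∈ s → up k j Δ ω m = 0)
    (hdown : ∀ m ∈ s, m + 1 ∉ s → down k j Δ ω m = 0) :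
    Submodule (A k) (DenseModel k j Δ ω) :=
  let S : Submodule ℂ (DenseModel k j Δ ω) :=
    { carrier := {f | ∀ m ∈ s, f m = 0}
      zero_mem' := fun _ _ => rfl
      add_mem' := fun {f g} hf hg m hm => by
        change f m + g m = 0
        rw [hf m hm, hg m hm, add_zero]
      smul_mem' := fun c f hf m hm => by
        change c * f m = 0
        rw [hf m hm, mul_zero] }
  { S.toAddSubmonoid with
    smul_mem' := fun a f hf => by
      refine smul_mem_of_generators (S := S) (fun f hf m hm => ?_) (fun f hf m hm => ?_)
        (fun f hf m hm => ?_) (fun f hf => ?_) a f hf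
      · rw [J_smul_apply, hf m hm, mul_zero]
      · rw [Gp_smul_apply]
        by_cases h : m - 1 ∈ s
        · rw [hf _ h, mul_zero]
        · rw [hup _ h (by rwa [sub_add_cancel]), zero_mul]
      · rw [Gm_smul_apply]
        by_cases h : m + 1 ∈ s
        · rw [hf _ h, mul_zero]
        · rw [hdown _ hm h, zero_mul]
      · rw [L_smul]
        exact S.smul_mem Δ hf }

theorem DenseModel.mem_vanishing {s : Set ℤ} {hup : ∀ m ∉ s, m + 1 ∈ s → up k j Δ ω m = 0}
    {hdown : ∀ m ∈ s, m + 1 ∉ s → down k j Δ ω m = 0} {f : DenseModel k j Δ ω} :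
    f ∈ vanishing s hup hdown ↔ ∀ m ∈ s, f m = 0 := Iff.rfl

theorem DenseModel.basisVec_mem_vanishing {s : Set ℤ}
    {hup : ∀ m ∉ s, m + 1 ∈ s → up k j Δ ω m = 0}
    {hdown : ∀ m ∈ s, m + 1 ∉ s → down k j Δ ω m = 0} {i : ℤ} :
    basisVec k j Δ ω i ∈ vanishing s hup hdown ↔ i ∉ s := by
  rw [mem_vanishing]
  refine ⟨fun h hi => one_ne_zero ((basisVec_self i).symm.trans (h i hi)), fun hi m hm => ?_⟩
  exact basisVec_of_ne fun h => hi (h ▸ hm)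

theorem not_isSimpleModule_of_eq {m : ℤ} (hω : ω = omegaP k (j + m) Δ) :
    ¬ IsSimpleModule (A k) (Rmod k j Δ ω) := by
  have hc : coeff k j Δ ω m = 0 := by rw [coeff, ← hω, sub_self, zero_div]
  rcases le_or_gt 0 m with hm | hm
  · refine not_isSimpleModule_of_submodule (a := Gp k ^ (m + 1).toNat)
      (W := vanishing (Set.Iic m) (fun i hi hi' => ?_) fun i hi hi' => ?_) ?_ ?_
      (Gp_pow_smul_rv_ne_zero k j Δ ω _)
    · simp only [Set.mem_Iic] at hi hi'
      lia
    · simp only [Set.mem_Iic] at hi hi'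
      obtain rfl : i = m := by lia
      rw [down, if_pos hm, hc]
    · rw [basisVec_mem_vanishing, not_not]
      exact hm
    · rw [Gp_pow_smul_basisVec_zero, basisVec_mem_vanishing, Set.mem_Iic]
      lia
  · refine not_isSimpleModule_of_submodule (a := Gm k ^ (-m).toNat)
      (W := vanishing (Set.Ioi m) (fun i hi hi' => ?_) fun i hi hi' => ?_) ?_ ?_
      (Gm_pow_smul_rv_ne_zero k j Δ ω _)
    · simp only [Set.mem_Ioi] at hi hi'
      obtain rfl : i = m := by lia
      rw [up, if_neg (by lia), hc]
    · simp only [Set.mem_Ioi] at hi hi'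
      lia
    · rw [basisVec_mem_vanishing, not_not]
      exact hm
    · rw [Gm_pow_smul_basisVec_zero, basisVec_mem_vanishing, Set.mem_Ioi]
      lia

end InducedModule

/-- in `R_{j,Δ,ω}` with generating vector `v`: (a) `G⁺·(G⁻)^{n+1} v = 0`
iff `ω = ω⁺_{j−n−1,Δ}`; (b) `G⁻·(G⁺)^{n+1} v = 0` iff `ω = ω⁻_{j+n+1,Δ}`;
(c) `R_{j,Δ,ω}` is simple iff `ω ≠ ω⁺_{i,Δ}` for every `i ∈ j + ℤ`. -/
theorem dense_module_structure (k j Δ ω : ℂ) :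
    (∀ n : ℕ, Gp k • (Gm k ^ (n + 1) • rv k j Δ ω) = 0 ↔ ω = omegaP k (j - n - 1) Δ) ∧
    (∀ n : ℕ, Gm k • (Gp k ^ (n + 1) • rv k j Δ ω) = 0 ↔ ω = omegaM k (j + n + 1) Δ) ∧
    (IsSimpleModule (A k) (Rmod k j Δ ω) ↔ ∀ m : ℤ, ω ≠ omegaP k (j + m) Δ) := by
  have hv := isWeightVector_rv k j Δ ω
  refine ⟨fun n => ?_, fun n => ?_, fun h m hω => not_isSimpleModule_of_eq hω h,
    isSimpleModule_of_forall_ne⟩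
  · rw [pow_succ', mul_smul, (hv.Gm_pow_smul n).Gp_Gm_smul,
      smul_eq_zero_iff_left (Gm_pow_smul_rv_ne_zero k j Δ ω n),
      div_eq_zero_iff, or_iff_left two_ne_zero, sub_eq_zero]
    congr! 1
    rw [omegaP, omegaM]
    ring
  · rw [pow_succ', mul_smul, (hv.Gp_pow_smul n).Gm_Gp_smul,
      smul_eq_zero_iff_left (Gp_pow_smul_rv_ne_zero k j Δ ω n),
      div_eq_zero_iff, or_iff_left two_ne_zero, sub_eq_zero]
    congr! 1
    rw [omegaP, omegaM]
    ring

end BP
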